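/- arXiv:0803.4454 — 2 statements merged into one kernel-verified Lean document; each statement's English description precedes it below -/
import Mathlib

section
/- The alternating group A_7 contains a subgroup isomorphic to PSL(2, 𝔽_7): there exists an injective group homomorphism from PSL(2, ℤ/7) into the alternating group on 7 letters. -/
/-- The projective special linear group `PSL(n, F)`: the quotient of `SL(n, F)` by its center. -/
abbrev PSL (n : ℕ) (F : Type) [Field F] :=
  Matrix.SpecialLinearGroup (Fin n) F ⧸ Subgroup.center (Matrix.SpecialLinearGroup (Fin n) F)

instance : Fact (Nat.Prime 7) := ⟨by norm_num⟩

section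

open Matrix
open scoped MatrixGroups

/-- A perfect group that is simple modulo its center, with a proper subgroup containing the center
and having at most `n` cosets, has its central quotient embedded in the alternating group on `n`
letters. -/
theorem exists_injective_quotient_center_alternatingGroup {G : Type*} [Group G] [Group.IsPerfect G]
    [IsSimpleGroup (G ⧸ Subgroup.center G)] {n : ℕ} (H : Subgroup G)
    (hZ : Subgroup.center G ≤ H) (hH : H ≠ ⊤) (e : G ⧸ H ↪ Fin n) :
    ∃ ψ : G ⧸ Subgroup.center G →* alternatingGroup (Fin n), Function.Injective ψ := by
  let φ : G →* Equiv.Perm (Fin n) :=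
    (Equiv.Perm.viaEmbeddingHom e).comp (MulAction.toPermHom G (G ⧸ H))
  have hker : φ.ker = H.normalCore := by
    rw [Subgroup.normalCore_eq_ker, MonoidHom.ker_comp_of_injective]
    exact Equiv.Perm.viaEmbeddingHom_injective e
  have hsign (g : G) : φ g ∈ alternatingGroup (Fin n) := by
    have hg : g ∈ (Equiv.Perm.sign.comp φ).ker := Abelianization.commutator_subset_ker _ <| by
      rw [Group.IsPerfect.commutator_eq_top]; trivial
    exact hg
  let ψ := QuotientGroup.lift (Subgroup.center G)
      (φ.codRestrict (alternatingGroup (Fin n)) hsign) <| by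
    rw [MonoidHom.ker_codRestrict, hker]
    exact Subgroup.normal_le_normalCore.2 hZ
  refine ⟨ψ, (MonoidHom.ker_eq_bot_iff ψ).1 <| ψ.normal_ker.eq_bot_or_eq_top.resolve_right fun h ↦
    hH <| top_unique <| le_trans (fun g _ ↦ ?_) H.normalCore_le⟩
  have hg : (g : G ⧸ Subgroup.center G) ∈ ψ.ker := h ▸ Subgroup.mem_top _
  rw [← hker]
  exact congrArg Subtype.val hg

/-- The coordinates `(p, q, r)` of the elements `!![p, q; r, -p]` of order `4` of a quaternion
subgroup of `SL(2, 𝔽₇)`. -/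
def quaternionCoords : Finset (ZMod 7 × ZMod 7 × ZMod 7) :=
  {(0, 1, -1), (0, -1, 1), (3, 2, 2), (-3, -2, -2), (2, -3, -3), (-2, 3, 3)}

/-- The elements of order `4` of a quaternion subgroup of `SL(2, 𝔽₇)`. -/
def quaternionSet : Set SL(2, ZMod 7) :=
  {m | ∃ x ∈ quaternionCoords, m.1 = !![x.1, x.2.1; x.2.2, -x.1]}

/-- The coordinates of the conjugate of `!![p, q; r, -p]` by `!![a, b; c, d]`. -/
def conjCoords {R : Type*} [CommRing R] (a b c d : R) (x : R × R × R) : R × R × R :=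
  ((a * x.1 + b * x.2.2) * d - (a * x.2.1 - b * x.1) * c,
    (a * x.2.1 - b * x.1) * a - (a * x.1 + b * x.2.2) * b,
    (c * x.1 + d * x.2.2) * d - (c * x.2.1 - d * x.1) * c)

theorem conj_eq_conjCoords {R : Type*} [CommRing R] (g m : SL(2, R)) {a b c d : R}
    (hg : g.1 = !![a, b; c, d]) {x : R × R × R} (hm : m.1 = !![x.1, x.2.1; x.2.2, -x.1]) :
    (g * m * g⁻¹).1 = !![(conjCoords a b c d x).1, (conjCoords a b c d x).2.1;
      (conjCoords a b c d x).2.2, -(conjCoords a b c d x).1] := by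
  change g.1 * m.1 * g.1.adjugate = _
  rw [hg, hm, adjugate_fin_two_of, mul_fin_two, mul_fin_two]
  ext i j
  fin_cases i <;> fin_cases j <;> simp [conjCoords] <;> ring

theorem mem_normalizer_quaternionSet {g : SL(2, ZMod 7)} {a b c d : ZMod 7}
    (hg : g.1 = !![a, b; c, d])
    (h : ∀ x ∈ quaternionCoords, conjCoords a b c d x ∈ quaternionCoords) :
    g ∈ Subgroup.normalizer quaternionSet :=
  Subgroup.mem_normalizer_fintype fun m ⟨x, hx, hm⟩ ↦ ⟨_, h x hx, conj_eq_conjCoords g m hg hm⟩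

theorem transvection_zero_one_eq {R : Type*} [CommRing R] (t : R) :
    (SpecialLinearGroup.transvection (zero_ne_one (α := Fin 2)) t).1 = !![1, t; 0, 1] := by
  ext i j
  fin_cases i <;> fin_cases j <;> simp [SpecialLinearGroup.transvection, Matrix.transvection]

theorem transvection_one_zero_eq {R : Type*} [CommRing R] (t : R) :
    (SpecialLinearGroup.transvection (one_ne_zero (α := Fin 2)) t).1 = !![1, 0; t, 1] := by
  ext i j
  fin_cases i <;> fin_cases j <;> simp [SpecialLinearGroup.transvection, Matrix.transvection]

/-- In coordinates: left multiplication by a lower transvection permutes the cosets of the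
normalizer of `quaternionSet` that are represented by upper transvections. -/
theorem exists_conjCoords_mem_quaternionCoords : ∀ a t : ZMod 7, ∃ u : ZMod 7,
    ∀ x ∈ quaternionCoords,
      conjCoords (1 - u * a) (t - u * (1 + a * t)) a (1 + a * t) x ∈ quaternionCoords := by
  unfold quaternionCoords conjCoords
  decide +kernel

theorem normalizer_quaternionSet_ne_top : Subgroup.normalizer quaternionSet ≠ ⊤ := by
  intro h
  let m : SL(2, ZMod 7) := ⟨!![0, 1; -1, 0], by simp⟩
  have hm : m ∈ quaternionSet := ⟨(0, 1, -1), by decide, by simp [m]⟩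
  obtain ⟨x, hx, hconj⟩ := (Subgroup.mem_set_normalizer_iff.1
    (h ▸ Subgroup.mem_top (SpecialLinearGroup.transvection zero_ne_one 1)) m).1 hm
  rw [conj_eq_conjCoords _ m (transvection_zero_one_eq 1) (x := (0, 1, -1)) (by simp [m])] at hconj
  have h00 := congr_fun₂ hconj 0 0
  have h01 := congr_fun₂ hconj 0 1
  simp [conjCoords] at h00 h01
  revert x
  decide +kernel

theorem surjective_transvection_quotient_normalizer_quaternionSet :
    Function.Surjective fun t : ZMod 7 ↦
      (SpecialLinearGroup.transvection (zero_ne_one (α := Fin 2)) t :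
        SL(2, ZMod 7) ⧸ Subgroup.normalizer quaternionSet) := by
  have key (g : SL(2, ZMod 7)) : ∀ t : ZMod 7, ∃ u : ZMod 7,
      (SpecialLinearGroup.transvection (zero_ne_one (α := Fin 2)) u)⁻¹ *
        (g * SpecialLinearGroup.transvection zero_ne_one t) ∈
          Subgroup.normalizer quaternionSet := by
    induction g using SL2.transvection_induction with
    | htransvec i j hij a =>
      intro t
      fin_cases i <;> fin_cases j
      · exact absurd rfl hij
      · refine ⟨a + t, ?_⟩
        rw [SpecialLinearGroup.transvection_add, inv_mul_cancel]
        exact one_mem _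
      · obtain ⟨u, hu⟩ := exists_conjCoords_mem_quaternionCoords a t
        refine ⟨u, mem_normalizer_quaternionSet ?_ hu⟩
        rw [SpecialLinearGroup.transvection_inv]
        change (SpecialLinearGroup.transvection zero_ne_one (-u)).1 *
          ((SpecialLinearGroup.transvection one_ne_zero a).1 *
            (SpecialLinearGroup.transvection zero_ne_one t).1) = _
        rw [transvection_zero_one_eq, transvection_zero_one_eq, transvection_one_zero_eq,
          mul_fin_two, mul_fin_two]
        ext i j
        fin_cases i <;> fin_cases j <;> simp <;> ring
      · exact absurd rfl hij
    | hmul g h hg hh =>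
      intro t
      obtain ⟨u, hu⟩ := hh t
      obtain ⟨v, hv⟩ := hg u
      refine ⟨v, ?_⟩
      convert mul_mem hv hu using 1
      group
  intro q
  obtain ⟨g, rfl⟩ := QuotientGroup.mk_surjective q
  obtain ⟨u, hu⟩ := key g 0
  exact ⟨u, QuotientGroup.eq.2 (by simpa using hu)⟩

end

/-- The alternating group `A_7` contains a subgroup isomorphic to `PSL(2, 𝔽_7)`. -/
theorem alternating_seven_contains_psl_two_seven :
    ∃ ψ : PSL 2 (ZMod 7) →* alternatingGroup (Fin 7), Function.Injective ψ := by
  have two_ne_zero : (2 : ZMod 7) ≠ 0 := by decide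
  have two_sq_ne_one : (2 : ZMod 7) ^ 2 ≠ 1 := by decide
  have : IsSimpleGroup (PSL 2 (ZMod 7)) :=
    Matrix.ProjectiveSpecialLinearGroup.rank_two_simple' (F := ZMod 7)
      ⟨2, two_ne_zero, two_sq_ne_one⟩
  have : Group.IsPerfect (Matrix.SpecialLinearGroup (Fin 2) (ZMod 7)) :=
    ⟨Matrix.SL2.commutator_eq_top two_ne_zero two_sq_ne_one⟩
  have hsurj := surjective_transvection_quotient_normalizer_quaternionSet
  exact exists_injective_quotient_center_alternatingGroup (Subgroup.normalizer quaternionSet)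
    (Subgroup.center_le_normalizer _) normalizer_quaternionSet_ne_top
    ⟨Function.surjInv hsurj, Function.injective_surjInv hsurj⟩
end

section
/- Every finite subgroup of the special orthogonal group SO(3) is either solvable or isomorphic to the alternating group A_5. In particular, A_5 is the only finite nonsolvable group acting faithfully and orientation-preservingly by isometries on the 2-sphere. -/
/-- The special orthogonal group `SO(3)`: the subgroup of the orthogonal group of real `3 × 3`
matrices consisting of matrices of determinant one. -/
def SO3 : Subgroup (Matrix.orthogonalGroup (Fin 3) ℝ) where
  carrier := {A | (A : Matrix (Fin 3) (Fin 3) ℝ).det = 1}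
  one_mem' := by simp
  mul_mem' := by
    intro a b ha hb
    simp only [Set.mem_setOf_eq, Submonoid.coe_mul, Matrix.det_mul] at *
    rw [ha, hb, mul_one]
  inv_mem' := by
    intro a ha
    simp only [Set.mem_setOf_eq] at *
    have h : ((a⁻¹ : Matrix.orthogonalGroup (Fin 3) ℝ) : Matrix (Fin 3) (Fin 3) ℝ) *
        (a : Matrix (Fin 3) (Fin 3) ℝ) = 1 := by
      rw [← Submonoid.coe_mul, inv_mul_cancel, Submonoid.coe_one]
    have := congrArg Matrix.det h
    rw [Matrix.det_mul, ha, mul_one, Matrix.det_one] at this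
    exact this

section SolvableSmallOrder

variable {G : Type*} [Group G]

/-- A finite group of squarefree order is solvable. -/
theorem isSolvable_of_squarefree_card [Finite G] (h : Squarefree (Nat.card G)) :
    Group.IsSolvable G :=
  have := IsZGroup.of_squarefree h
  inferInstance

/-- A group with a solvable subgroup of index at most three is solvable. -/
theorem isSolvable_of_index_le_three [Finite G] (K : Subgroup G) [Group.IsSolvable K]
    (hK : K.index ≤ 3) : Group.IsSolvable G := by
  classical
  have hle : (MulAction.toPermHom G (G ⧸ K)).ker ≤ K :=
    K.normalCore_eq_ker ▸ K.normalCore_le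
  have hpos : K.index ≠ 0 := K.index_ne_zero_of_finite
  have hperm : Group.IsSolvable (Equiv.Perm (G ⧸ K)) := by
    apply isSolvable_of_squarefree_card
    rw [Nat.card_perm, ← Subgroup.index_eq_card]
    interval_cases K.index
    · contradiction
    · simp
    · exact Nat.prime_two.squarefree
    · rw [show Nat.factorial 3 = 2 * 3 from rfl, Nat.squarefree_mul (by norm_num)]
      exact ⟨Nat.prime_two.squarefree, Nat.prime_three.squarefree⟩
  exact Group.isSolvable_of_ker_le_range K.subtype _ (hle.trans K.range_subtype.ge)

/-- A finite group of order `3 * 2 ^ n` is solvable. -/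
theorem isSolvable_of_card_eq_three_mul_two_pow [Finite G] {n : ℕ}
    (h : Nat.card G = 3 * 2 ^ n) : Group.IsSolvable G := by
  obtain ⟨K, hK⟩ := Sylow.exists_subgroup_card_pow_prime (G := G) 2 (n := n)
    (h ▸ Dvd.intro_left _ rfl)
  have : Group.IsNilpotent K := (IsPGroup.of_card hK).isNilpotent
  refine isSolvable_of_index_le_three K ?_
  have := K.card_mul_index
  rw [hK, h, mul_comm] at this
  exact (Nat.eq_of_mul_eq_mul_right (by positivity) this).le

/-- A group of order `20` is solvable. -/
theorem isSolvable_of_card_eq_twenty [Finite G] (h : Nat.card G = 20) : Group.IsSolvable G := by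
  have : Fact (Nat.Prime 5) := ⟨Nat.prime_five⟩
  let P : Sylow 5 G := default
  have hP : Nat.card (P : Subgroup G) = 5 := by
    rw [P.card_eq_multiplicity, h, show (20 : ℕ) = 5 * 4 by norm_num,
      Nat.factorization_mul (by norm_num) (by norm_num)]
    simp [Nat.prime_five.factorization, Nat.factorization_eq_zero_of_not_dvd]
  have hi : (P : Subgroup G).index = 4 := by
    have := (P : Subgroup G).card_mul_index
    rw [h, hP] at this
    omega
  have h1 : Nat.card (Sylow 5 G) = 1 := by
    have hd := P.card_dvd_index
    have hm := card_sylow_modEq_one 5 G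
    rw [hi] at hd
    have := Nat.le_of_dvd (by norm_num) hd
    unfold Nat.ModEq at hm
    omega
  have hn : (P : Subgroup G).Normal := by
    rw [← Subgroup.normalizer_eq_top_iff, ← Subgroup.index_eq_one]
    exact P.card_eq_index_normalizer ▸ h1
  have : IsCyclic P := isCyclic_of_prime_card hP
  have : Group.IsSolvable (G ⧸ (P : Subgroup G)) := by
    have : Group.IsNilpotent (G ⧸ (P : Subgroup G)) :=
      (IsPGroup.of_card (p := 2) (n := 2)
        (by rw [← Subgroup.index_eq_card, hi]; norm_num)).isNilpotent
    infer_instance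
  exact (Group.isSolvable_iff_subgroup_quotient (P : Subgroup G)).2 ⟨inferInstance, this⟩

/-- A group whose order is a proper divisor of `60` is solvable. -/
theorem isSolvable_of_card_dvd_sixty [Finite G] (h : Nat.card G ∣ 60) (h' : Nat.card G ≠ 60) :
    Group.IsSolvable G := by
  by_cases h20 : Nat.card G = 20
  · exact isSolvable_of_card_eq_twenty h20
  by_cases h12 : Nat.card G = 12
  · exact isSolvable_of_card_eq_three_mul_two_pow (n := 2) (by rw [h12]; norm_num)
  by_cases h4 : Nat.card G = 4
  · have : Group.IsNilpotent G :=
      (IsPGroup.of_card (p := 2) (n := 2) (by rw [h4]; norm_num)).isNilpotent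
    infer_instance
  apply isSolvable_of_squarefree_card
  have hmem : Nat.card G ∈ Nat.divisors 60 := by simpa using h
  have key : ∀ n ∈ Nat.divisors 60, n ≠ 60 → n ≠ 20 → n ≠ 12 → n ≠ 4 → Squarefree n := by
    decide +kernel
  exact key _ hmem h' h20 h12 h4

/-- A group of order `60` is solvable or isomorphic to the alternating group on five letters. -/
theorem isSolvable_or_mulEquiv_alternatingGroup_of_card_eq_sixty [Finite G]
    (h : Nat.card G = 60) :
    Group.IsSolvable G ∨ Nonempty (G ≃* alternatingGroup (Fin 5)) := by
  have hnormal (N : Subgroup G) [N.Normal] (h1 : Nat.card N ≠ 1) (h60 : Nat.card N ≠ 60) :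
      Group.IsSolvable G := by
    have hmul := N.card_mul_index
    rw [h] at hmul
    rw [Group.isSolvable_iff_subgroup_quotient N]
    refine ⟨isSolvable_of_card_dvd_sixty (Dvd.intro _ hmul) h60,
      isSolvable_of_card_dvd_sixty ?_ ?_⟩ <;> rw [← Subgroup.index_eq_card]
    · exact Dvd.intro_left _ hmul
    · intro hi
      rw [hi] at hmul
      omega
  let P : Sylow 2 G := default
  have hP : Nat.card (P : Subgroup G) = 4 := by
    rw [P.card_eq_multiplicity, h, show (60 : ℕ) = 2 ^ 2 * 15 by norm_num,
      Nat.factorization_mul (by norm_num) (by norm_num)]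
    have h4 : Nat.factorization (2 ^ 2) 2 = 2 := by
      rw [Nat.prime_two.factorization_pow]
      simp
    have h15 : Nat.factorization 15 2 = 0 := Nat.factorization_eq_zero_of_not_dvd (by norm_num)
    rw [Finsupp.add_apply, h4, h15]
    norm_num
  have hPi : (P : Subgroup G).index = 15 := by
    have := (P : Subgroup G).card_mul_index
    rw [h, hP] at this
    omega
  have hcomm (a b : (P : Subgroup G)) : a * b = b * a :=
    (IsPGroup.commGroupOfCardEqPrimeSq (p := 2) (by rw [hP]; norm_num)).mul_comm a b
  set N := Subgroup.normalizer (P : Set G) with hN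
  have hPN : (P : Subgroup G) ≤ N := Subgroup.le_normalizer
  have hcard : Nat.card (Sylow 2 G) = N.index := P.card_eq_index_normalizer
  have hmul := N.card_mul_index
  rw [h] at hmul
  have hdvd : N.index ∈ Nat.divisors 15 := by
    simpa [hcard, hPi] using P.card_dvd_index
  have hcases : N.index = 1 ∨ N.index = 3 ∨ N.index = 5 ∨ N.index = 15 := by
    have : Nat.divisors 15 = {1, 3, 5, 15} := by decide +kernel
    simpa [this] using hdvd
  rcases hcases with hi | hi | hi | hi
  · left
    have : (P : Subgroup G).Normal := by
      rw [← Subgroup.normalizer_eq_top_iff, ← Subgroup.index_eq_one]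
      exact hi
    exact hnormal P (by omega) (by omega)
  · left
    have : Group.IsSolvable N :=
      isSolvable_of_card_dvd_sixty (Dvd.intro _ hmul) (by rw [hi] at hmul; omega)
    exact isSolvable_of_index_le_three N hi.le
  · let f := MulAction.toPermHom G (Sylow 2 G)
    have hfN : f.ker ≤ N := fun g hg ↦ by
      rw [← P.smul_eq_iff_mem_normalizer]
      exact Equiv.Perm.ext_iff.1 hg P
    by_cases hf : Nat.card f.ker = 1
    · right
      have hinj : Function.Injective f := by
        rw [← MonoidHom.ker_eq_bot_iff]
        exact Subgroup.eq_bot_of_card_eq _ hf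
      let e : Sylow 2 G ≃ Fin 5 := Finite.equivFinOfCardEq (hcard.trans hi)
      let F : G →* Equiv.Perm (Fin 5) := e.permCongrHom.toMonoidHom.comp f
      have hF : Function.Injective F := e.permCongrHom.injective.comp hinj
      have hr : F.range = alternatingGroup (Fin 5) := by
        apply Equiv.Perm.eq_alternatingGroup_of_index_eq_two
        have := F.range.card_mul_index
        rw [← Nat.card_congr (MonoidHom.ofInjective hF).toEquiv, h, Nat.card_perm,
          Nat.card_eq_fintype_card, Fintype.card_fin] at this
        norm_num [Nat.factorial] at this
        omega
      exact ⟨(MonoidHom.ofInjective hF).trans (MulEquiv.subgroupCongr hr)⟩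
    · left
      refine hnormal f.ker hf fun h60 ↦ ?_
      have := Subgroup.card_le_of_le hfN
      rw [hi] at hmul
      omega
  · left
    have hPN' : (P : Subgroup G) = N := by
      refine Subgroup.eq_of_le_of_card_ge hPN ?_
      rw [hi] at hmul
      omega
    have hc : N ≤ Subgroup.centralizer (P : Set G) := by
      rw [← hPN']
      exact fun a ha b hb ↦ congrArg Subtype.val (hcomm ⟨b, hb⟩ ⟨a, ha⟩)
    have hK := (MonoidHom.ker_transferSylow_isComplement' P hc).card_mul_card
    rw [hP, h] at hK
    exact hnormal (MonoidHom.transferSylow P hc).ker (by omega) (by omega)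

end SolvableSmallOrder

section OrbitCount

theorem two_or_three_or_four_or_five_or_six_le {m r N : ℕ} (hr : 2 ≤ r) (h : m * r = N) :
    m * 2 = N ∨ m * 3 = N ∨ m * 4 = N ∨ m * 5 = N ∨ m * 6 ≤ N := by
  subst h
  obtain h6 | h6 := le_or_gt 6 r
  · exact Or.inr <| Or.inr <| Or.inr <| Or.inr <| Nat.mul_le_mul_left m h6
  · interval_cases r <;> simp

/-- The arithmetic of the orbit count for finite rotation groups: if `N` and the orbit sizes
`m ω` satisfy the Burnside equation and all stabilizer orders are at least two, then `N` is one of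
`1`, `12`, `24`, `60`, or some orbit has at most two points. -/
theorem orbit_sizes_of_burnside_equation {Ω : Type*} [Fintype Ω] {m : Ω → ℕ} {N : ℕ}
    (hN : 0 < N) (hm : ∀ ω, ∃ r, 2 ≤ r ∧ m ω * r = N)
    (h : ∑ ω, m ω + 2 * N = Fintype.card Ω * N + 2) :
    N = 1 ∨ (∃ ω, m ω ≤ 2) ∨ N = 12 ∨ N = 24 ∨ N = 60 := by
  obtain ⟨k, hk, ⟨e⟩⟩ : ∃ k, Fintype.card Ω = k ∧ Nonempty (Ω ≃ Fin k) :=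
    ⟨_, rfl, ⟨Fintype.equivFin Ω⟩⟩
  have hm2 (ω : Ω) : m ω * 2 ≤ N := by
    obtain ⟨r, hr, rfl⟩ := hm ω
    exact Nat.mul_le_mul_left _ hr
  have hsum : (∑ ω, m ω) * 2 ≤ Fintype.card Ω * N := by
    rw [Finset.sum_mul]
    simpa using Finset.sum_le_card_nsmul Finset.univ _ N fun ω _ ↦ hm2 ω
  have hcard : k < 4 := by
    rw [hk] at h hsum
    nlinarith
  rw [hk, ← e.symm.sum_comp] at h
  have hm' (i) : _ ∨ _ :=
    let ⟨_, hr, hrN⟩ := hm (e.symm i)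
    two_or_three_or_four_or_five_or_six_le hr hrN
  suffices H : N = 1 ∨ (∃ i, m (e.symm i) ≤ 2) ∨ N = 12 ∨ N = 24 ∨ N = 60 from
    H.imp_right <| Or.imp_left fun ⟨i, hi⟩ ↦ ⟨_, hi⟩
  clear hm hm2 hsum
  interval_cases k <;>
    simp only [Fin.exists_fin_succ, Fin.sum_univ_succ, Fin.forall_fin_succ, Finset.univ_eq_empty,
      Finset.sum_empty, IsEmpty.exists_iff, IsEmpty.forall_iff, Fin.succ_zero_eq_one,
      Fin.succ_one_eq_two] at h hm' ⊢
  all_goals omega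

open MulAction

/-- If every nontrivial element of a finite group fixes exactly two points, every point has a
nontrivial solvable stabilizer, then the group is solvable or isomorphic to `A₅`. -/
theorem isSolvable_or_mulEquiv_alternatingGroup_of_card_fixedBy_eq_two {G X : Type*} [Group G]
    [Finite G] [Finite X] [MulAction G X] (hfix : ∀ g : G, g ≠ 1 → Nat.card (fixedBy X g) = 2)
    (hnontrivial : ∀ x : X, Nontrivial (stabilizer G x))
    (hsolv : ∀ x : X, Group.IsSolvable (stabilizer G x)) :
    Group.IsSolvable G ∨ Nonempty (G ≃* alternatingGroup (Fin 5)) := by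
  classical
  have := Fintype.ofFinite G
  have := Fintype.ofFinite X
  have hX : Fintype.card X =
      ∑ ω : orbitRel.Quotient G X, (stabilizer G ω.out).index := by
    rw [card_eq_sum_card_group_div_card_stabilizer G X]
    refine Finset.sum_congr rfl fun ω _ ↦ ?_
    rw [← Nat.card_eq_fintype_card, ← Nat.card_eq_fintype_card,
      ← (stabilizer G ω.out).card_mul_index, Nat.mul_div_cancel_left _ Nat.card_pos]
  have hburnside : ∑ g : G, Fintype.card (fixedBy X g) =
      Fintype.card (orbitRel.Quotient G X) * Fintype.card G :=
    sum_card_fixedBy_eq_card_orbits_mul_card_group G X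
  have hcompl : ∑ g ∈ ({1}ᶜ : Finset G), Fintype.card (fixedBy X g) = 2 * (Nat.card G - 1) := by
    rw [Finset.sum_congr rfl (g := fun _ ↦ 2), Finset.sum_const, Finset.card_compl]
    · simp [mul_comm]
    · intro g hg
      rw [← Nat.card_eq_fintype_card, hfix g (by simpa using hg)]
  have hone : Fintype.card (fixedBy X (1 : G)) = Fintype.card X := by
    rw [← Nat.card_eq_fintype_card, ← Nat.card_eq_fintype_card, fixedBy_one_eq_univ]
    exact Nat.card_univ
  rw [Fintype.sum_eq_add_sum_compl 1, hcompl, hone, hX, ← Nat.card_eq_fintype_card (α := G)]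
    at hburnside
  have hpos : 0 < Nat.card G := Nat.card_pos
  obtain h | ⟨ω, h⟩ | h | h | h := orbit_sizes_of_burnside_equation hpos
    (fun ω : orbitRel.Quotient G X ↦ ⟨Nat.card (stabilizer G ω.out), Finite.one_lt_card,
      (stabilizer G ω.out).index_mul_card⟩) (by omega)
  · have := (Nat.card_eq_one_iff_unique.1 h).1
    exact Or.inl inferInstance
  · have := hsolv ω.out
    exact Or.inl (isSolvable_of_index_le_three _ (h.trans (by norm_num)))
  · exact Or.inl (isSolvable_of_card_eq_three_mul_two_pow (n := 2) (by rw [h]; norm_num))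
  · exact Or.inl (isSolvable_of_card_eq_three_mul_two_pow (n := 3) (by rw [h]; norm_num))
  · exact isSolvable_or_mulEquiv_alternatingGroup_of_card_eq_sixty h

end OrbitCount

section Rotation

open Matrix

variable {A B : Matrix (Fin 3) (Fin 3) ℝ} {v w x : Fin 3 → ℝ}

theorem mulVec_crossProduct_of_transpose_mul_self (hA : Aᵀ * A = 1) (hdet : A.det = 1)
    (v w : Fin 3 → ℝ) : A *ᵥ (v ⨯₃ w) = (A *ᵥ v) ⨯₃ (A *ᵥ w) := by
  have hadj : A.adjugate = Aᵀ := by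
    calc A.adjugate = Aᵀ * A * A.adjugate := by rw [hA, one_mul]
      _ = Aᵀ := by rw [mul_assoc, mul_adjugate, hdet, one_smul, mul_one]
  have h (i j) : A i j = A.adjugate j i := by rw [hadj, transpose_apply]
  have key : A *ᵥ (v ⨯₃ w) = A.adjugateᵀ *ᵥ (v ⨯₃ w) := by
    rw [hadj, transpose_transpose]
  rw [key, adjugate_fin_three]
  ext i
  fin_cases i <;>
  · simp [cross_apply, mulVec, dotProduct, Fin.sum_univ_three]
    ring

theorem dotProduct_mulVec_mulVec_of_transpose_mul_self (hA : Aᵀ * A = 1) (v w : Fin 3 → ℝ) :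
    (A *ᵥ v) ⬝ᵥ (A *ᵥ w) = v ⬝ᵥ w := by
  rw [dotProduct_mulVec, vecMul_mulVec, hA, vecMul_one]

/-- A rotation fixing two independent vectors is trivial. -/
theorem eq_one_of_mulVec_eq_of_crossProduct_ne_zero (hA : Aᵀ * A = 1) (hdet : A.det = 1)
    (hv : A *ᵥ v = v) (hw : A *ᵥ w = w) (hvw : v ⨯₃ w ≠ 0) : A = 1 := by
  have hc : A *ᵥ (v ⨯₃ w) = v ⨯₃ w := by
    rw [mulVec_crossProduct_of_transpose_mul_self hA hdet, hv, hw]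
  let M : Matrix (Fin 3) (Fin 3) ℝ := of ![v ⨯₃ w, v, w]
  have hM : IsUnit M.det := by
    have : M.det = (v ⨯₃ w) ⬝ᵥ (v ⨯₃ w) := (triple_product_eq_det _ _ _).symm
    rw [this]
    exact isUnit_iff_ne_zero.2 (dotProduct_self_eq_zero.not.2 hvw)
  have hAM : M * Aᵀ = M * 1 := by
    ext i j
    rw [mul_one]
    fin_cases i
    · simpa [M, mul_apply, mulVec, dotProduct, mul_comm] using congrFun hc j
    · simpa [M, mul_apply, mulVec, dotProduct, mul_comm] using congrFun hv j
    · simpa [M, mul_apply, mulVec, dotProduct, mul_comm] using congrFun hw j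
  rw [← transpose_inj, transpose_one]
  exact (isUnit_iff_isUnit_det M |>.2 hM).mul_left_cancel hAM

/-- Every rotation of three-space fixes a unit vector. -/
theorem exists_unit_mulVec_eq (hA : Aᵀ * A = 1) (hdet : A.det = 1) :
    ∃ v : Fin 3 → ℝ, v ⬝ᵥ v = 1 ∧ A *ᵥ v = v := by
  have h0 : (A - 1).det = 0 := by
    have h1 : Aᵀ * (A - 1) = -(A - 1)ᵀ := by
      rw [mul_sub, hA, transpose_sub, transpose_one, mul_one, neg_sub]
    have h2 := congrArg det h1
    rw [det_mul, det_transpose, hdet, det_neg, det_transpose] at h2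
    norm_num at h2
    linarith
  obtain ⟨v, hv0, hv⟩ := exists_mulVec_eq_zero_iff.2 h0
  rw [sub_mulVec, one_mulVec, sub_eq_zero] at hv
  have hpos : 0 < v ⬝ᵥ v :=
    lt_of_le_of_ne (Finset.sum_nonneg fun i _ ↦ mul_self_nonneg _)
      (Ne.symm (dotProduct_self_eq_zero.not.2 hv0))
  refine ⟨(√(v ⬝ᵥ v))⁻¹ • v, ?_, by rw [mulVec_smul, hv]⟩
  rw [smul_dotProduct, dotProduct_smul, smul_eq_mul, smul_eq_mul, ← mul_assoc, ← mul_inv,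
    Real.mul_self_sqrt hpos.le, inv_mul_cancel₀ hpos.ne']

theorem eq_or_eq_neg_of_crossProduct_eq_zero (hv : v ⬝ᵥ v = 1) (hw : w ⬝ᵥ w = 1)
    (h : v ⨯₃ w = 0) : w = v ∨ w = -v := by
  have hwv : w = (v ⬝ᵥ w) • v := by
    have := cross_cross_eq_smul_sub_smul' v v w
    rw [h, hv, one_smul, map_zero] at this
    exact (sub_eq_zero.1 this.symm).symm
  have hsq : (v ⬝ᵥ w) * (v ⬝ᵥ w) = 1 := by
    have := hw
    rw [hwv, smul_dotProduct, dotProduct_smul, hv] at this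
    simpa using this
  rcases mul_self_eq_one_iff.1 hsq with h1 | h1 <;> rw [h1] at hwv
  · exact Or.inl (by simpa using hwv)
  · exact Or.inr (by simpa using hwv)

/-- A nontrivial rotation fixes exactly one unit vector up to sign. -/
theorem eq_or_eq_neg_of_mulVec_eq (hA : Aᵀ * A = 1) (hdet : A.det = 1) (hA1 : A ≠ 1)
    (hv : v ⬝ᵥ v = 1) (hw : w ⬝ᵥ w = 1) (hAv : A *ᵥ v = v) (hAw : A *ᵥ w = w) :
    w = v ∨ w = -v :=
  eq_or_eq_neg_of_crossProduct_eq_zero hv hw <| by_contra fun h ↦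
    hA1 (eq_one_of_mulVec_eq_of_crossProduct_ne_zero hA hdet hAv hAw h)

theorem exists_dotProduct_eq_zero_and_ne_zero (v : Fin 3 → ℝ) :
    ∃ w, v ⬝ᵥ w = 0 ∧ w ≠ 0 := by
  by_cases h : v 0 = 0 ∧ v 1 = 0
  · exact ⟨![1, 0, 0], by rw [vec3_dotProduct]; simp [h.1], fun h' ↦ by simpa using congrFun h' 0⟩
  · refine ⟨![-v 1, v 0, 0], by rw [vec3_dotProduct]; simp; ring, fun h' ↦ h ⟨?_, ?_⟩⟩
    · simpa using congrFun h' 1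
    · simpa using congrFun h' 0

/-- Expansion of a vector orthogonal to the unit vector `v` along `w` and `v ⨯₃ w`. -/
theorem smul_eq_add_crossProduct (hv : v ⬝ᵥ v = 1) (hw : v ⬝ᵥ w = 0) (hx : v ⬝ᵥ x = 0) :
    (w ⬝ᵥ w) • x = (x ⬝ᵥ w) • w + (x ⬝ᵥ (v ⨯₃ w)) • (v ⨯₃ w) := by
  have h1 : w ⨯₃ (v ⨯₃ w) = (w ⬝ᵥ w) • v := by
    rw [cross_cross_eq_smul_sub_smul', hw, zero_smul, sub_zero]
  have h2 : v ⨯₃ (v ⨯₃ w) = -w := by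
    rw [cross_cross_eq_smul_sub_smul', hw, hv, zero_smul, one_smul, zero_sub]
  have h3 : v ⨯₃ (x ⨯₃ v) = x := by
    rw [cross_cross_eq_smul_sub_smul', hv, dotProduct_comm x v, hx, zero_smul, one_smul, sub_zero]
  calc (w ⬝ᵥ w) • x = v ⨯₃ (x ⨯₃ (w ⨯₃ (v ⨯₃ w))) := by
        rw [h1, map_smul, map_smul, h3]
    _ = _ := by
        rw [cross_cross_eq_smul_sub_smul' x w, dotProduct_comm w x, map_sub, map_smul, map_smul, h2,
          smul_neg, sub_neg_eq_add, add_comm]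

/-- Rotations fixing a common unit vector commute. -/
theorem mul_comm_of_mulVec_eq (hA : Aᵀ * A = 1) (hAdet : A.det = 1) (hB : Bᵀ * B = 1)
    (hBdet : B.det = 1) (hv : v ⬝ᵥ v = 1) (hAv : A *ᵥ v = v) (hBv : B *ᵥ v = v) :
    A * B = B * A := by
  obtain ⟨w, hvw, hw0⟩ := exists_dotProduct_eq_zero_and_ne_zero v
  have hww : w ⬝ᵥ w ≠ 0 := dotProduct_self_eq_zero.not.2 hw0
  have hexp {C : Matrix (Fin 3) (Fin 3) ℝ} (hC : Cᵀ * C = 1) (hCv : C *ᵥ v = v) :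
      ∃ a b : ℝ, C *ᵥ w = a • w + b • (v ⨯₃ w) := by
    have h0 : v ⬝ᵥ (C *ᵥ w) = 0 := by
      conv_lhs => rw [← hCv]
      rw [dotProduct_mulVec_mulVec_of_transpose_mul_self hC, hvw]
    have := congrArg ((w ⬝ᵥ w)⁻¹ • ·) (smul_eq_add_crossProduct hv hvw h0)
    simp only [smul_smul, inv_mul_cancel₀ hww, one_smul, smul_add] at this
    exact ⟨_, _, this⟩
  obtain ⟨a, b, hAw⟩ := hexp hA hAv
  obtain ⟨c, d, hBw⟩ := hexp hB hBv
  have hAJ : A *ᵥ (v ⨯₃ w) = v ⨯₃ (A *ᵥ w) := by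
    rw [mulVec_crossProduct_of_transpose_mul_self hA hAdet, hAv]
  have hBJ : B *ᵥ (v ⨯₃ w) = v ⨯₃ (B *ᵥ w) := by
    rw [mulVec_crossProduct_of_transpose_mul_self hB hBdet, hBv]
  have hABw : A *ᵥ (B *ᵥ w) = B *ᵥ (A *ᵥ w) := by
    rw [hBw, mulVec_add, mulVec_smul, mulVec_smul, hAJ, hAw, mulVec_add, mulVec_smul, mulVec_smul,
      hBJ, hBw]
    simp only [map_add, map_smul]
    module
  have hABv : A *ᵥ (B *ᵥ v) = B *ᵥ (A *ᵥ v) := by rw [hBv, hAv, hBv]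
  have hBA : (B * A)ᵀ * (B * A) = 1 := by
    rw [transpose_mul, mul_assoc, ← mul_assoc Bᵀ, hB, one_mul, hA]
  have hAB : (A * B)ᵀ * (A * B) = 1 := by
    rw [transpose_mul, mul_assoc, ← mul_assoc Aᵀ, hA, one_mul, hB]
  have hBA' := mul_eq_one_comm.1 hBA
  have hdetC : ((B * A)ᵀ * (A * B)).det = 1 := by
    rw [det_mul, det_transpose, det_mul, det_mul, hAdet, hBdet]
    norm_num
  have hC : (B * A)ᵀ * (A * B) = 1 := by
    refine eq_one_of_mulVec_eq_of_crossProduct_ne_zero (v := v) (w := w) ?_ hdetC ?_ ?_ fun h ↦ ?_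
    · rw [transpose_mul, transpose_transpose, mul_assoc, ← mul_assoc (B * A), hBA', one_mul, hAB]
    · rw [← mulVec_mulVec, ← mulVec_mulVec, hABv, mulVec_mulVec v B A, mulVec_mulVec, hBA,
        one_mulVec]
    · rw [← mulVec_mulVec, ← mulVec_mulVec, hABw, mulVec_mulVec w B A, mulVec_mulVec, hBA,
        one_mulVec]
    · have := cross_cross_eq_smul_sub_smul' v v w
      rw [h, map_zero, hvw, hv, zero_smul, one_smul, zero_sub] at this
      exact hw0 (neg_eq_zero.1 this.symm)
  calc A * B = B * A * (B * A)ᵀ * (A * B) := by rw [hBA', one_mul]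
    _ = B * A := by rw [mul_assoc, hC, mul_one]

end Rotation

section Poles

open Matrix

variable {G : Type*} [Group G]

/-- The unit vectors fixed by some nontrivial element of a matrix representation on `ℝ³`. -/
abbrev Poles (ρ : G →* Matrix (Fin 3) (Fin 3) ℝ) : Type :=
  {v : Fin 3 → ℝ // v ⬝ᵥ v = 1 ∧ ∃ g : G, g ≠ 1 ∧ ρ g *ᵥ v = v}

/-- An orthogonal representation acts on its poles. -/
@[reducible]
def polesMulAction (ρ : G →* Matrix (Fin 3) (Fin 3) ℝ) (hρ : ∀ g, (ρ g)ᵀ * ρ g = 1) :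
    MulAction G (Poles ρ) where
  smul g v := ⟨ρ g *ᵥ v.1, by
    obtain ⟨v, hv, h, h1, hh⟩ := v
    refine ⟨?_, g * h * g⁻¹, by simpa using h1, ?_⟩
    · rw [dotProduct_mulVec_mulVec_of_transpose_mul_self (hρ g), hv]
    · rw [mulVec_mulVec, ← map_mul, inv_mul_cancel_right, map_mul, ← mulVec_mulVec]
      exact congrArg _ hh⟩
  one_smul v := Subtype.ext (by change ρ 1 *ᵥ v.1 = v.1; rw [map_one, one_mulVec])
  mul_smul g h v := Subtype.ext (by
    change ρ (g * h) *ᵥ v.1 = ρ g *ᵥ (ρ h *ᵥ v.1)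
    rw [map_mul, mulVec_mulVec])

/-- A finite group with a faithful representation by rotations of `ℝ³` is solvable or isomorphic
to `A₅`. -/
theorem isSolvable_or_mulEquiv_alternatingGroup_of_rotations [Finite G]
    (ρ : G →* Matrix (Fin 3) (Fin 3) ℝ) (hinj : Function.Injective ρ)
    (hρ : ∀ g, (ρ g)ᵀ * ρ g = 1) (hdet : ∀ g, (ρ g).det = 1) :
    Group.IsSolvable G ∨ Nonempty (G ≃* alternatingGroup (Fin 5)) := by
  let := polesMulAction ρ hρ
  have hsmul (g : G) (x : Poles ρ) : g • x = x ↔ ρ g *ᵥ x.1 = x.1 := Subtype.ext_iff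
  have hne {g : G} (hg : g ≠ 1) : ρ g ≠ 1 := fun h ↦ hg (hinj (h.trans (map_one ρ).symm))
  have hfixed (g : G) (hg : g ≠ 1) :
      ∃ p q : Poles ρ, p ≠ q ∧ MulAction.fixedBy (Poles ρ) g = {p, q} := by
    obtain ⟨v, hv, hgv⟩ := exists_unit_mulVec_eq (hρ g) (hdet g)
    refine ⟨⟨v, hv, g, hg, hgv⟩, ⟨-v, by simpa using hv, g, hg, by rw [mulVec_neg, hgv]⟩,
      fun h ↦ ?_, ?_⟩
    · have h0 : v = 0 := self_eq_neg.1 (congrArg Subtype.val h)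
      simp [h0] at hv
    · ext x
      rw [MulAction.mem_fixedBy, hsmul, Set.mem_insert_iff, Set.mem_singleton_iff,
        Subtype.ext_iff, Subtype.ext_iff]
      refine ⟨eq_or_eq_neg_of_mulVec_eq (hρ g) (hdet g) (hne hg) hv x.2.1 hgv, ?_⟩
      rintro (h | h) <;> rw [h]
      · exact hgv
      · exact (mulVec_neg _ _).trans (congrArg _ hgv)
  have : Finite (Poles ρ) := by
    have huniv : (Set.univ : Set (Poles ρ)) =
        ⋃ g : {g : G // g ≠ 1}, MulAction.fixedBy (Poles ρ) g.1 := by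
      ext x
      obtain ⟨g, hg, hgx⟩ := x.2.2
      simpa using ⟨g, hg, (hsmul g x).2 hgx⟩
    rw [← Set.finite_univ_iff, huniv]
    refine Set.finite_iUnion fun g ↦ ?_
    obtain ⟨p, q, -, h⟩ := hfixed g.1 g.2
    exact h ▸ Set.toFinite _
  refine isSolvable_or_mulEquiv_alternatingGroup_of_card_fixedBy_eq_two (X := Poles ρ)
    (fun g hg ↦ ?_) (fun x ↦ ?_) (fun x ↦ ?_)
  · obtain ⟨p, q, hpq, h⟩ := hfixed g hg
    rw [h]
    exact Set.ncard_pair hpq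
  · obtain ⟨g, hg, hgx⟩ := x.2.2
    exact ⟨⟨⟨g, (hsmul g x).2 hgx⟩, 1, fun h ↦ hg (congrArg Subtype.val h)⟩⟩
  · refine Group.isSolvable_of_comm fun g h ↦ Subtype.ext (hinj ?_)
    change ρ (g.1 * h.1) = ρ (h.1 * g.1)
    rw [map_mul, map_mul]
    exact mul_comm_of_mulVec_eq (hρ _) (hdet _) (hρ _) (hdet _) x.2.1 ((hsmul _ x).1 g.2)
      ((hsmul _ x).1 h.2)

end Poles

/-- Every finite subgroup of `SO(3)` is either solvable or isomorphic to the alternating group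
`A_5`; in particular `A_5` is the only finite nonsolvable group acting faithfully and
orientation-preservingly by isometries on the 2-sphere. -/
theorem finite_subgroup_SO3_solvable_or_A5 (H : Subgroup SO3) (hH : Finite H) :
    IsSolvable H ∨ Nonempty (H ≃* alternatingGroup (Fin 5)) := by
  let ρ : H →* Matrix (Fin 3) (Fin 3) ℝ :=
    (Submonoid.subtype (Matrix.orthogonalGroup (Fin 3) ℝ)).comp (SO3.subtype.comp H.subtype)
  exact isSolvable_or_mulEquiv_alternatingGroup_of_rotations ρ
    (Subtype.val_injective.comp (Subtype.val_injective.comp Subtype.val_injective))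
    (fun g ↦ (Matrix.mem_orthogonalGroup_iff' _ _).1 g.1.1.2) (fun g ↦ g.1.2)
end
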